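/- Let p ∈ (2,∞). Let φ, ψ : [1,∞) → [1,∞) be increasing functions with φ(1) = ψ(1) = 1 (depending only on p) such that, for every positive integer d and all weights w, σ on ℝ^d with [σ]_{A_∞} < ∞ and [w]_{A_∞} < ∞, one has ‖S(·σ)‖_{L^p(σ)→L^p(w)} ≤ C(p,d) · [w,σ]_{A_p}^{1/p} (φ([w]_{A_∞}) + ψ([σ]_{A_∞})). Then there exist absolute constants A, B > 0 such that ψ(x) ≥ c_p x^{1/p} for all x > A and φ(x) ≥ c_p x^{1/2−1/p} for all x > B, where c_p > 0 depends only on p. -/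

import Mathlib

open MeasureTheory Set Filter
open scoped ENNReal NNReal

noncomputable section

/-- The "cube" (axis-parallel box) `[a₁,b₁) × ⋯ × [a_d,b_d)` in `ℝ^d`. -/
def cubeD (d : ℕ) (a b : Fin d → ℝ) : Set (Fin d → ℝ) :=
  Set.univ.pi fun i => Set.Ico (a i) (b i)

/-- Average of `g` over the cube `[a₁,b₁) × ⋯ × [a_d,b_d)`. -/
def cubeAvg (d : ℕ) (g : (Fin d → ℝ) → ℝ) (a b : Fin d → ℝ) : ℝ :=
  (∏ i, (b i - a i))⁻¹ * ∫ x in cubeD d a b, g x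

/-- The dyadic cube `∏_i [kᵢ 2^{-n}, (kᵢ+1) 2^{-n})`. -/
def dcube (d : ℕ) (n : ℤ) (k : Fin d → ℤ) : Set (Fin d → ℝ) :=
  cubeD d (fun i => (k i : ℝ) * (2:ℝ) ^ (-n)) (fun i => ((k i : ℝ) + 1) * (2:ℝ) ^ (-n))

/-- Average over the dyadic cube `dcube d n k`. -/
def dcubeAvg (d : ℕ) (g : (Fin d → ℝ) → ℝ) (n : ℤ) (k : Fin d → ℤ) : ℝ :=
  cubeAvg d g (fun i => (k i : ℝ) * (2:ℝ) ^ (-n)) (fun i => ((k i : ℝ) + 1) * (2:ℝ) ^ (-n))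

/-- Index of the dyadic child of `dcube d n k` selected by `ε : Fin d → Bool`. -/
def childIdx (d : ℕ) (k : Fin d → ℤ) (ε : Fin d → Bool) : Fin d → ℤ :=
  fun i => 2 * k i + (if ε i then 1 else 0)

/-- The martingale difference `Δ_Q g` associated with the dyadic cube `Q = dcube d n k`:
`Δ_Q g = Σ_{R child of Q} ⟨g⟩_R 1_R − ⟨g⟩_Q 1_Q`. -/
def deltaCube (d : ℕ) (g : (Fin d → ℝ) → ℝ) (n : ℤ) (k : Fin d → ℤ) (x : Fin d → ℝ) : ℝ :=
  (∑ ε : Fin d → Bool,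
    (dcube d (n+1) (childIdx d k ε)).indicator
      (fun _ => dcubeAvg d g (n+1) (childIdx d k ε)) x)
  - (dcube d n k).indicator (fun _ => dcubeAvg d g n k) x

/-- The dyadic square function on `ℝ^d`. -/
def sqFnD (d : ℕ) (g : (Fin d → ℝ) → ℝ) (x : Fin d → ℝ) : ℝ :=
  Real.sqrt (∑' q : ℤ × (Fin d → ℤ), (deltaCube d g q.1 q.2 x) ^ 2)

/-- `‖g‖_{L^p(w)}` on `ℝ^d` (as an extended nonnegative real). -/
def pNormD (d : ℕ) (p : ℝ) (g w : (Fin d → ℝ) → ℝ) : ℝ≥0∞ :=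
  (∫⁻ x : Fin d → ℝ, ENNReal.ofReal (|g x| ^ p * w x)) ^ (1/p)

/-- The joint `A_p` characteristic `[w,σ]_{A_p}` on `ℝ^d`, the supremum running over all
cubes. -/
def apCharD (d : ℕ) (p : ℝ) (w σ : (Fin d → ℝ) → ℝ) : ℝ≥0∞ :=
  ⨆ (a : Fin d → ℝ) (b : Fin d → ℝ) (_ : ∀ i, a i < b i),
    ENNReal.ofReal (cubeAvg d w a b * (cubeAvg d σ a b) ^ (p - 1))

/-- Local maximal function `M_Q σ (x) = sup { ⟨σ⟩_R : R cube ⊆ Q, x ∈ R }` for the cube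
`Q = cubeD d a b`. -/
def maxFnD (d : ℕ) (σ : (Fin d → ℝ) → ℝ) (a b x : Fin d → ℝ) : ℝ≥0∞ :=
  ⨆ (c : Fin d → ℝ) (e : Fin d → ℝ) (_ : ∀ i, c i < e i)
    (_ : cubeD d c e ⊆ cubeD d a b) (_ : x ∈ cubeD d c e),
      ENNReal.ofReal (cubeAvg d σ c e)

/-- The Fujii–Wilson `A_∞` characteristic on `ℝ^d`:
`[σ]_{A_∞} = sup_Q (1/σ(Q)) ∫_Q M_Q σ`, the supremum over all cubes. -/
def ainfCharD (d : ℕ) (σ : (Fin d → ℝ) → ℝ) : ℝ≥0∞ :=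
  ⨆ (a : Fin d → ℝ) (b : Fin d → ℝ) (_ : ∀ i, a i < b i),
    (∫⁻ x in cubeD d a b, maxFnD d σ a b x) /
      ENNReal.ofReal (∫ x in cubeD d a b, σ x)

/-- A weight on `ℝ^d`: measurable, a.e. positive, and integrable over every cube. -/
def IsWeightD (d : ℕ) (w : (Fin d → ℝ) → ℝ) : Prop :=
  Measurable w ∧ (∀ᵐ x : Fin d → ℝ, 0 < w x) ∧
    ∀ a b : Fin d → ℝ, (∀ i, a i < b i) → IntegrableOn w (cubeD d a b)

section PowerWeights

lemma integrable_abs_rpow_Ico {r : ℝ} (hr : -1 < r) (a b : ℝ) :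
    IntegrableOn (fun t : ℝ => |t| ^ r) (Ico a b) := by
  have key : ∀ c : ℝ, 0 ≤ c → IntervalIntegrable (fun t : ℝ => |t| ^ r) volume 0 c := by
    intro c hc
    refine (intervalIntegral.intervalIntegrable_rpow' hr (a := 0) (b := c)).congr ?_
    intro t ht
    rw [uIoc_of_le hc] at ht
    simp [abs_of_pos ht.1]
  have key' : ∀ c : ℝ, IntervalIntegrable (fun t : ℝ => |t| ^ r) volume 0 c := by
    intro c
    rcases le_total 0 c with hc | hc
    · exact key c hc
    · have := (key (-c) (by linarith)).comp_sub_left 0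
      simpa using this
  have h : IntervalIntegrable (fun t : ℝ => |t| ^ r) volume a b := (key' a).symm.trans (key' b)
  rcases le_total a b with hab | hab
  · rw [intervalIntegrable_iff_integrableOn_Ico_of_le hab] at h
    exact h
  · simp [Ico_eq_empty (not_lt.mpr hab)]

lemma setIntegral_rpow_Ico_zero {r b : ℝ} (hr : -1 < r) (hb : 0 ≤ b) :
    ∫ t in Ico 0 b, t ^ r = b ^ (r + 1) / (r + 1) := by
  rw [integral_Ico_eq_integral_Ioc, ← intervalIntegral.integral_of_le hb,
    integral_rpow (Or.inl hr), Real.zero_rpow (by linarith)]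
  simp

lemma setIntegral_abs_rpow_Ico_neg {r b : ℝ} (hr : -1 < r) (hb : 0 ≤ b) :
    ∫ t in Ico (-b) b, |t| ^ r = 2 * (b ^ (r + 1) / (r + 1)) := by
  have hi : ∀ c e : ℝ, c ≤ e → IntervalIntegrable (fun t : ℝ => |t| ^ r) volume c e := by
    intro c e hce
    rw [intervalIntegrable_iff_integrableOn_Ico_of_le hce]
    exact integrable_abs_rpow_Ico hr c e
  have h0 : ∫ t in (0:ℝ)..b, |t| ^ r = b ^ (r + 1) / (r + 1) := by
    rw [← setIntegral_rpow_Ico_zero hr hb, integral_Ico_eq_integral_Ioc,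
      intervalIntegral.integral_of_le hb]
    refine setIntegral_congr_fun measurableSet_Ioc fun t ht => ?_
    simp [abs_of_pos ht.1]
  have h1 : ∫ t in (-b)..0, |t| ^ r = b ^ (r + 1) / (r + 1) := by
    rw [← h0]
    have := intervalIntegral.integral_comp_neg (a := 0) (b := b) (fun t : ℝ => |t| ^ r)
    simp only [abs_neg, neg_zero] at this
    exact this.symm
  rw [integral_Ico_eq_integral_Ioc, ← intervalIntegral.integral_of_le (by linarith),
    ← intervalIntegral.integral_add_adjacent_intervals (hi (-b) 0 (by linarith)) (hi 0 b hb),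
    h0, h1]
  ring

lemma abs_le_max_of_mem_Ico {a b t : ℝ} (ht : t ∈ Ico a b) : |t| ≤ max |a| |b| :=
  abs_le_max_abs_abs ht.1 ht.2.le

lemma max_abs_pos_of_lt {a b : ℝ} (hab : a < b) : 0 < max |a| |b| := by
  rcases eq_or_ne a 0 with h | h
  · exact lt_max_of_lt_right (abs_pos.mpr (by linarith [h ▸ hab]))
  · exact lt_max_of_lt_left (abs_pos.mpr h)

lemma setAverage_le_of_le {g : ℝ → ℝ} {a b M : ℝ} (hab : a < b)
    (hg : IntegrableOn g (Ico a b)) (hM : ∀ t ∈ Ico a b, g t ≤ M) :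
    (b - a)⁻¹ * ∫ t in Ico a b, g t ≤ M := by
  have h : ∫ t in Ico a b, g t ≤ ∫ t in Ico a b, M :=
    setIntegral_mono_on hg (integrableOn_const (by simp)) measurableSet_Ico hM
  have h2 : ∫ t in Ico a b, M = (b - a) * M := by
    simp [hab.le]
  rw [inv_mul_le_iff₀ (by linarith)]
  linarith

/-- The average of `|t|^(δ-1)` over an interval is at most `4/δ` times its infimum there. -/
lemma average_abs_rpow_neg_le {δ a b : ℝ} (hδ : 0 < δ) (hδ1 : δ ≤ 1) (hab : a < b) :
    (b - a)⁻¹ * ∫ t in Ico a b, |t| ^ (δ - 1) ≤ 4 / δ * max |a| |b| ^ (δ - 1) := by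
  set m := max |a| |b| with hm
  have hmpos : 0 < m := max_abs_pos_of_lt hab
  have hsub : Ico a b ⊆ Ico (-m) m := by
    intro t ht
    have h1 : -m ≤ a := by
      have := neg_abs_le a
      have := le_max_left |a| |b|
      linarith
    have h2 : b ≤ m := (le_abs_self b).trans (le_max_right _ _)
    exact ⟨h1.trans ht.1, ht.2.trans_le h2⟩
  have hmp : 0 < m ^ (δ - 1) := Real.rpow_pos_of_pos hmpos _
  rcases le_or_gt (m / 2) (b - a) with h | h
  · have h1 : ∫ t in Ico a b, |t| ^ (δ - 1) ≤ 2 * (m ^ δ / δ) := by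
      calc ∫ t in Ico a b, |t| ^ (δ - 1) ≤ ∫ t in Ico (-m) m, |t| ^ (δ - 1) := by
            refine setIntegral_mono_set (integrable_abs_rpow_Ico (by linarith) _ _) ?_
              hsub.eventuallyLE
            exact Eventually.of_forall fun t => by positivity
        _ = _ := by
            rw [setIntegral_abs_rpow_Ico_neg (by linarith) hmpos.le]
            simp
    have h2 : m ^ δ = m * m ^ (δ - 1) := by
      rw [Real.rpow_sub_one hmpos.ne']
      field_simp
    rw [inv_mul_le_iff₀ (by linarith)]
    calc _ ≤ 2 * (m ^ δ / δ) := h1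
      _ = m / 2 * (4 / δ * m ^ (δ - 1)) := by rw [h2]; ring
      _ ≤ _ := by gcongr
  · refine setAverage_le_of_le hab (integrable_abs_rpow_Ico (by linarith) _ _) fun t ht => ?_
    have ht2 : m / 2 ≤ |t| := by
      rcases max_choice |a| |b| with h3 | h3
      · have h4 : m = |a| := h3
        have : |a| ≤ |t| + |a - t| := by
          have := abs_add_le t (a - t)
          simpa using this
        have h5 : |a - t| ≤ b - a := by
          rw [abs_le]; constructor <;> linarith [ht.1, ht.2]
        linarith
      · have h4 : m = |b| := h3
        have : |b| ≤ |t| + |b - t| := by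
          have := abs_add_le t (b - t)
          simpa using this
        have h5 : |b - t| ≤ b - a := by
          rw [abs_le]; constructor <;> linarith [ht.1, ht.2]
        linarith
    calc |t| ^ (δ - 1) ≤ (m / 2) ^ (δ - 1) :=
          Real.rpow_le_rpow_of_nonpos (by positivity) ht2 (by linarith)
      _ = 2 ^ (1 - δ) * m ^ (δ - 1) := by
          rw [Real.div_rpow hmpos.le (by norm_num), show (1 - δ) = -(δ - 1) by ring,
            Real.rpow_neg (by norm_num)]
          field_simp
      _ ≤ 4 / δ * m ^ (δ - 1) := by
          gcongr
          calc (2:ℝ) ^ (1 - δ) ≤ 2 ^ (1:ℝ) :=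
                Real.rpow_le_rpow_of_exponent_le (by norm_num) (by linarith)
            _ ≤ 4 / δ := by
                rw [le_div_iff₀ hδ]; norm_num; linarith

lemma average_abs_rpow_le {r a b : ℝ} (hr : 0 ≤ r) (hab : a < b) :
    (b - a)⁻¹ * ∫ t in Ico a b, |t| ^ r ≤ max |a| |b| ^ r :=
  setAverage_le_of_le hab (integrable_abs_rpow_Ico (by linarith) _ _) fun _ ht =>
    Real.rpow_le_rpow (abs_nonneg _) (abs_le_max_of_mem_Ico ht) hr

/-- For `r ≥ 0`, the integral of `|t|^r` over an interval is comparable to its supremum there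
times the length. -/
lemma le_setIntegral_abs_rpow {r a b : ℝ} (hr : 0 ≤ r) (hab : a < b) :
    (b - a) * max |a| |b| ^ r ≤ 4 * 2 ^ r * ∫ t in Ico a b, |t| ^ r := by
  set m := max |a| |b| with hm
  have hmpos : 0 < m := max_abs_pos_of_lt hab
  have hsub : ∃ c, Ico c (c + (b - a) / 4) ⊆ Ico a b ∧
      ∀ t ∈ Ico c (c + (b - a) / 4), m / 2 ≤ |t| := by
    have hba : b - a ≤ 2 * m := by
      have h1 := le_abs_self b
      have h2 := neg_abs_le a
      have h3 : |a| ≤ m := le_max_left _ _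
      have h4 : |b| ≤ m := le_max_right _ _
      linarith
    rcases max_choice |a| |b| with h3 | h3
    · have h4 : m = |a| := h3
      refine ⟨a, Ico_subset_Ico le_rfl (by linarith), fun t ht => ?_⟩
      have h5 : |a| ≤ |t| + |a - t| := by
        have := abs_add_le t (a - t)
        simpa using this
      have h6 : |a - t| ≤ (b - a) / 4 := by
        rw [abs_le]; constructor <;> linarith [ht.1, ht.2]
      linarith
    · have h4 : m = |b| := h3
      refine ⟨b - (b - a) / 4, Ico_subset_Ico (by linarith) (by linarith), fun t ht => ?_⟩
      have h5 : |b| ≤ |t| + |b - t| := by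
        have := abs_add_le t (b - t)
        simpa using this
      have h6 : |b - t| ≤ (b - a) / 4 := by
        rw [abs_le]; constructor <;> linarith [ht.1, ht.2]
      linarith
  obtain ⟨c, hc1, hc2⟩ := hsub
  have h1 : (b - a) / 4 * (m / 2) ^ r ≤ ∫ t in Ico a b, |t| ^ r := by
    calc (b - a) / 4 * (m / 2) ^ r = ∫ t in Ico c (c + (b - a) / 4), (m / 2) ^ r := by
          have : 0 ≤ (b - a) / 4 := by linarith
          simp [this]
      _ ≤ ∫ t in Ico c (c + (b - a) / 4), |t| ^ r := by
          refine setIntegral_mono_on (integrableOn_const (by simp))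
            (integrable_abs_rpow_Ico (by linarith) _ _) measurableSet_Ico fun t ht => ?_
          exact Real.rpow_le_rpow (by positivity) (hc2 t ht) hr
      _ ≤ _ := by
          refine setIntegral_mono_set (integrable_abs_rpow_Ico (by linarith) _ _) ?_
            hc1.eventuallyLE
          exact Eventually.of_forall fun t => by positivity
  have h2 : (m / 2) ^ r * 2 ^ r = m ^ r := by
    rw [← Real.mul_rpow (by positivity) (by norm_num)]
    congr 1
    ring
  calc (b - a) * m ^ r = 4 * 2 ^ r * ((b - a) / 4 * (m / 2) ^ r) := by rw [← h2]; ring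
    _ ≤ _ := by gcongr

end PowerWeights

section OneDimensional

lemma cubeD_one (a b : Fin 1 → ℝ) :
    cubeD 1 a b = MeasurableEquiv.funUnique (Fin 1) ℝ ⁻¹' Ico (a 0) (b 0) := by
  ext x
  simp [cubeD, MeasurableEquiv.funUnique, Fin.forall_fin_one]

lemma mem_cubeD_one {a b x : Fin 1 → ℝ} : x ∈ cubeD 1 a b ↔ x 0 ∈ Ico (a 0) (b 0) := by
  simp [cubeD, Fin.forall_fin_one]

lemma measurableSet_cubeD_one (a b : Fin 1 → ℝ) : MeasurableSet (cubeD 1 a b) := by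
  rw [cubeD_one]
  exact (MeasurableEquiv.measurable _) measurableSet_Ico

lemma setIntegral_cubeD_one (g : ℝ → ℝ) (a b : Fin 1 → ℝ) :
    ∫ x in cubeD 1 a b, g (x 0) = ∫ t in Ico (a 0) (b 0), g t := by
  rw [cubeD_one]
  exact (volume_preserving_funUnique (Fin 1) ℝ).setIntegral_preimage_emb
    (MeasurableEquiv.measurableEmbedding _) g (Ico (a 0) (b 0))

lemma lintegral_fin_one (g : ℝ → ℝ≥0∞) :
    ∫⁻ x : Fin 1 → ℝ, g (x 0) = ∫⁻ t, g t :=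
  (volume_preserving_funUnique (Fin 1) ℝ).lintegral_comp_emb
    (MeasurableEquiv.measurableEmbedding _) g

lemma volume_cubeD_one (a b : Fin 1 → ℝ) :
    volume (cubeD 1 a b) = ENNReal.ofReal (b 0 - a 0) := by
  rw [cubeD_one]
  exact ((volume_preserving_funUnique (Fin 1) ℝ).measure_preimage_equiv _).trans
    Real.volume_Ico

lemma cubeAvg_one (g : ℝ → ℝ) (a b : Fin 1 → ℝ) :
    cubeAvg 1 (fun x => g (x 0)) a b = (b 0 - a 0)⁻¹ * ∫ t in Ico (a 0) (b 0), g t := by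
  simp [cubeAvg, setIntegral_cubeD_one]

lemma isWeightD_abs_rpow {r : ℝ} (hr : -1 < r) : IsWeightD 1 (fun x => |x 0| ^ r) := by
  have hqmp := volume_preserving_funUnique (Fin 1) ℝ
  refine ⟨by fun_prop, ?_, fun a b _ => ?_⟩
  · have h : ∀ᵐ t : ℝ, 0 < |t| ^ r := by
      filter_upwards [Measure.ae_ne volume (0:ℝ)] with t ht
      exact Real.rpow_pos_of_pos (abs_pos.mpr ht) _
    exact hqmp.quasiMeasurePreserving.ae h
  · rw [cubeD_one]
    exact (hqmp.integrableOn_comp_preimage (MeasurableEquiv.measurableEmbedding _)).mpr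
      (integrable_abs_rpow_Ico hr (a 0) (b 0))

lemma one_le_ainfCharD_abs_rpow {r : ℝ} (hr : -1 < r) :
    1 ≤ ainfCharD 1 (fun x => |x 0| ^ r) := by
  set I : ℝ := ∫ x in cubeD 1 (fun _ => 0) (fun _ => 1), |x 0| ^ r with hI
  have hIpos : 0 < I := by
    rw [hI, setIntegral_cubeD_one (fun t => |t| ^ r)]
    have : ∫ t in Ico (0:ℝ) 1, |t| ^ r = ∫ t in Ico (0:ℝ) 1, t ^ r :=
      setIntegral_congr_fun measurableSet_Ico fun t ht => by simp [abs_of_nonneg ht.1]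
    rw [this, setIntegral_rpow_Ico_zero hr zero_le_one]
    have : 0 < r + 1 := by linarith
    simpa using this
  have hmax : ∀ x ∈ cubeD 1 (fun _ => 0) (fun _ => 1), ENNReal.ofReal I ≤
      maxFnD 1 (fun x => |x 0| ^ r) (fun _ => 0) (fun _ => 1) x := by
    intro x hx
    unfold maxFnD
    refine le_iSup₂_of_le (fun _ => 0) (fun _ => 1) (le_iSup₂_of_le (by simp) subset_rfl
      (le_iSup_of_le hx ?_))
    simp [cubeAvg, hI]
  have h1 : ENNReal.ofReal I ≤ ∫⁻ x in cubeD 1 (fun _ => 0) (fun _ => 1),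
      maxFnD 1 (fun x => |x 0| ^ r) (fun _ => 0) (fun _ => 1) x := by
    calc ENNReal.ofReal I = ∫⁻ x in cubeD 1 (fun _ => 0) (fun _ => 1), ENNReal.ofReal I := by
          simp [volume_cubeD_one]
      _ ≤ _ := setLIntegral_mono' (measurableSet_cubeD_one _ _) hmax
  unfold ainfCharD
  refine le_iSup₂_of_le (fun _ => 0) (fun _ => 1) (le_iSup_of_le (by simp) ?_)
  rw [ENNReal.le_div_iff_mul_le (Or.inl (by simpa using hIpos)) (Or.inl (by simp)), one_mul]
  exact h1

lemma ainfCharD_one_le {g : ℝ → ℝ} {K : ℝ} (hK : 0 ≤ K)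
    (h : ∀ a b : Fin 1 → ℝ, a 0 < b 0 →
      ∫⁻ x in cubeD 1 a b, maxFnD 1 (fun x => g (x 0)) a b x ≤
        ENNReal.ofReal (K * ∫ t in Ico (a 0) (b 0), g t)) :
    ainfCharD 1 (fun x => g (x 0)) ≤ ENNReal.ofReal K := by
  unfold ainfCharD
  refine iSup₂_le fun a b => iSup_le fun hab => ?_
  refine ENNReal.div_le_of_le_mul ?_
  rw [setIntegral_cubeD_one, ← ENNReal.ofReal_mul hK]
  exact h a b (hab 0)

lemma maxFnD_one_le {g : ℝ → ℝ} {a b x : Fin 1 → ℝ} {M : ℝ}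
    (h : ∀ c e : ℝ, c < e → Ico c e ⊆ Ico (a 0) (b 0) → x 0 ∈ Ico c e →
      (e - c)⁻¹ * ∫ t in Ico c e, g t ≤ M) :
    maxFnD 1 (fun x => g (x 0)) a b x ≤ ENNReal.ofReal M := by
  unfold maxFnD
  refine iSup₂_le fun c e => iSup₂_le fun hce hsub => iSup_le fun hx => ?_
  rw [cubeAvg_one]
  refine ENNReal.ofReal_le_ofReal (h _ _ (hce 0) ?_ (mem_cubeD_one.mp hx))
  intro t ht
  have : (fun _ : Fin 1 => t) ∈ cubeD 1 c e := mem_cubeD_one.mpr ht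
  exact mem_cubeD_one.mp (hsub this)

lemma ainfCharD_abs_rpow_neg_le {δ : ℝ} (hδ : 0 < δ) (hδ1 : δ ≤ 1) :
    ainfCharD 1 (fun x => |x 0| ^ (δ - 1)) ≤ ENNReal.ofReal (4 / δ) := by
  refine ainfCharD_one_le (g := fun t => |t| ^ (δ - 1)) (by positivity) fun a b hab => ?_
  have hmax : ∀ᵐ x : Fin 1 → ℝ, x ∈ cubeD 1 a b →
      maxFnD 1 (fun x => |x 0| ^ (δ - 1)) a b x ≤ ENNReal.ofReal (4 / δ * |x 0| ^ (δ - 1)) := by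
    have h0 : ∀ᵐ x : Fin 1 → ℝ, x 0 ≠ 0 :=
      (volume_preserving_funUnique (Fin 1) ℝ).quasiMeasurePreserving.ae
        (Measure.ae_ne volume (0:ℝ))
    filter_upwards [h0] with x hx _
    refine maxFnD_one_le (g := fun t => |t| ^ (δ - 1)) fun c e hce _ hmem => ?_
    refine (average_abs_rpow_neg_le hδ hδ1 hce).trans ?_
    gcongr ?_ * ?_
    exact Real.rpow_le_rpow_of_nonpos (abs_pos.mpr hx) (abs_le_max_of_mem_Ico hmem)
      (by linarith)
  calc _ ≤ ∫⁻ x in cubeD 1 a b, ENNReal.ofReal (4 / δ * |x 0| ^ (δ - 1)) :=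
        setLIntegral_mono_ae' (measurableSet_cubeD_one a b) hmax
    _ = ENNReal.ofReal (∫ x in cubeD 1 a b, 4 / δ * |x 0| ^ (δ - 1)) := by
        refine (ofReal_integral_eq_lintegral_ofReal ?_ ?_).symm
        · refine Integrable.const_mul ?_ _
          exact (isWeightD_abs_rpow (by linarith)).2.2 a b (by simpa [Fin.forall_fin_one])
        · exact Eventually.of_forall fun x => by positivity
    _ = _ := by
        rw [integral_const_mul, setIntegral_cubeD_one (fun t => |t| ^ (δ - 1))]

lemma ainfCharD_abs_rpow_le {r : ℝ} (hr : 0 ≤ r) :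
    ainfCharD 1 (fun x => |x 0| ^ r) ≤ ENNReal.ofReal (4 * 2 ^ r) := by
  refine ainfCharD_one_le (g := fun t => |t| ^ r) (by positivity) fun a b hab => ?_
  have hmax : ∀ x ∈ cubeD 1 a b,
      maxFnD 1 (fun x => |x 0| ^ r) a b x ≤ ENNReal.ofReal (max |a 0| |b 0| ^ r) := by
    intro x _
    refine maxFnD_one_le (g := fun t => |t| ^ r) fun c e hce hsub _ => ?_
    refine setAverage_le_of_le hce (integrable_abs_rpow_Ico (by linarith) _ _) fun t ht => ?_
    exact Real.rpow_le_rpow (abs_nonneg _) (abs_le_max_of_mem_Ico (hsub ht)) hr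
  calc _ ≤ ∫⁻ x in cubeD 1 a b, ENNReal.ofReal (max |a 0| |b 0| ^ r) :=
        setLIntegral_mono' (measurableSet_cubeD_one a b) hmax
    _ = ENNReal.ofReal ((b 0 - a 0) * max |a 0| |b 0| ^ r) := by
        rw [setLIntegral_const, volume_cubeD_one, mul_comm,
          ← ENNReal.ofReal_mul (by linarith)]
    _ ≤ _ := ENNReal.ofReal_le_ofReal (le_setIntegral_abs_rpow hr hab)

lemma average_abs_rpow_nonneg (r : ℝ) {a b : ℝ} (hab : a < b) :
    0 ≤ (b - a)⁻¹ * ∫ t in Ico a b, |t| ^ r :=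
  mul_nonneg (by simpa using hab.le) (integral_nonneg fun t => by positivity)

/-- The joint characteristic when the singular weight is the second one. -/
lemma apCharD_right_singular_le {p δ : ℝ} (hp : 1 ≤ p) (hδ : 0 < δ) (hδ1 : δ ≤ 1) :
    apCharD 1 p (fun x => |x 0| ^ ((1 - δ) * (p - 1))) (fun x => |x 0| ^ (δ - 1)) ≤
      ENNReal.ofReal ((4 / δ) ^ (p - 1)) := by
  unfold apCharD
  refine iSup₂_le fun a b => iSup_le fun hab => ENNReal.ofReal_le_ofReal ?_
  rw [cubeAvg_one (fun t => |t| ^ ((1 - δ) * (p - 1))), cubeAvg_one (fun t => |t| ^ (δ - 1))]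
  have hm := max_abs_pos_of_lt (hab 0)
  set m := max |a 0| |b 0|
  have h1 := average_abs_rpow_le (r := (1 - δ) * (p - 1))
    (mul_nonneg (by linarith) (by linarith)) (hab 0)
  have h2 := Real.rpow_le_rpow (average_abs_rpow_nonneg (δ - 1) (hab 0))
    (average_abs_rpow_neg_le hδ hδ1 (hab 0)) (by linarith : 0 ≤ p - 1)
  refine (mul_le_mul h1 h2 (Real.rpow_nonneg (average_abs_rpow_nonneg _ (hab 0)) _)
    (by positivity)).trans_eq ?_
  rw [Real.mul_rpow (by positivity) (by positivity), ← Real.rpow_mul hm.le,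
    mul_left_comm, ← Real.rpow_add hm]
  ring_nf
  simp

/-- The joint characteristic when the singular weight is the first one. -/
lemma apCharD_left_singular_le {p δ : ℝ} (hp : 1 < p) (hδ : 0 < δ) (hδ1 : δ ≤ 1) :
    apCharD 1 p (fun x => |x 0| ^ (δ - 1)) (fun x => |x 0| ^ ((1 - δ) / (p - 1))) ≤
      ENNReal.ofReal (4 / δ) := by
  unfold apCharD
  refine iSup₂_le fun a b => iSup_le fun hab => ENNReal.ofReal_le_ofReal ?_
  rw [cubeAvg_one (fun t => |t| ^ ((1 - δ) / (p - 1))), cubeAvg_one (fun t => |t| ^ (δ - 1))]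
  have hm := max_abs_pos_of_lt (hab 0)
  set m := max |a 0| |b 0|
  have hp1 : 0 < p - 1 := by linarith
  have h1 := average_abs_rpow_le (r := (1 - δ) / (p - 1))
    (div_nonneg (by linarith) hp1.le) (hab 0)
  have h2 := Real.rpow_le_rpow (average_abs_rpow_nonneg _ (hab 0)) h1 hp1.le
  refine (mul_le_mul (average_abs_rpow_neg_le hδ hδ1 (hab 0)) h2
    (Real.rpow_nonneg (average_abs_rpow_nonneg _ (hab 0)) _)
    (by positivity)).trans_eq ?_
  rw [← Real.rpow_mul hm.le, div_mul_cancel₀ _ hp1.ne', mul_assoc, ← Real.rpow_add hm]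
  ring_nf
  simp

end OneDimensional

section SquareFunction

/-- The dyadic interval `[k 2⁻ⁿ, (k+1) 2⁻ⁿ)`. -/
def dyadicIco (n k : ℤ) : Set ℝ := Ico ((k:ℝ) * 2 ^ (-n)) (((k:ℝ) + 1) * 2 ^ (-n))

/-- The average of `g` over `dyadicIco n k`. -/
def dyadicAvg (g : ℝ → ℝ) (n k : ℤ) : ℝ := 2 ^ n * ∫ t in dyadicIco n k, g t

lemma mem_dyadicIco {n k : ℤ} {t : ℝ} : t ∈ dyadicIco n k ↔ ⌊t * 2 ^ n⌋ = k := by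
  have h : (0:ℝ) < 2 ^ n := by positivity
  rw [Int.floor_eq_iff, dyadicIco, mem_Ico, zpow_neg, ← div_eq_mul_inv, ← div_eq_mul_inv,
    div_le_iff₀ h, lt_div_iff₀ h]

lemma dyadicIco_zero (n : ℤ) : dyadicIco n 0 = Ico 0 (2 ^ (-n)) := by
  simp [dyadicIco]

lemma floor_child (n : ℤ) (t : ℝ) :
    ⌊t * 2 ^ (n + 1)⌋ = 2 * ⌊t * 2 ^ n⌋ ∨ ⌊t * 2 ^ (n + 1)⌋ = 2 * ⌊t * 2 ^ n⌋ + 1 := by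
  rw [zpow_add_one₀ (by norm_num), ← mul_assoc]
  set y := t * 2 ^ n
  have h1 := Int.floor_le y
  have h2 := Int.lt_floor_add_one y
  have h3 : 2 * ⌊y⌋ ≤ ⌊y * 2⌋ := by
    rw [Int.le_floor]; push_cast; linarith
  have h4 : ⌊y * 2⌋ < 2 * ⌊y⌋ + 2 := by
    rw [Int.floor_lt]; push_cast; linarith
  omega

lemma dcubeAvg_one (g : ℝ → ℝ) (n : ℤ) (k : Fin 1 → ℤ) :
    dcubeAvg 1 (fun y => g (y 0)) n k = dyadicAvg g n (k 0) := by
  rw [dcubeAvg, cubeAvg_one, dyadicAvg, dyadicIco]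
  congr 1
  rw [add_mul, add_sub_cancel_left, one_mul, zpow_neg, inv_inv]

lemma mem_dcube_one {n : ℤ} {k : Fin 1 → ℤ} {x : Fin 1 → ℝ} :
    x ∈ dcube 1 n k ↔ x 0 ∈ dyadicIco n (k 0) :=
  mem_cubeD_one

open Classical in
/-- On the line, the martingale difference at `x` is the average over the child containing `x`
minus the average over the interval. -/
lemma deltaCube_one (g : ℝ → ℝ) (n : ℤ) (k : Fin 1 → ℤ) (x : Fin 1 → ℝ) :
    deltaCube 1 (fun y => g (y 0)) n k x =
      if x 0 ∈ dyadicIco n (k 0) then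
        dyadicAvg g (n + 1) ⌊x 0 * 2 ^ (n + 1)⌋ - dyadicAvg g n (k 0) else 0 := by
  have hsum : ∀ F : (Fin 1 → Bool) → ℝ,
      ∑ ε : Fin 1 → Bool, F ε = F (fun _ => true) + F (fun _ => false) := by
    intro F
    rw [← (Equiv.funUnique (Fin 1) Bool).symm.sum_comp F, Fintype.sum_bool]
    rfl
  rw [deltaCube, hsum]
  simp only [indicator, mem_dcube_one, dcubeAvg_one, childIdx, mem_dyadicIco, if_true,
    Bool.false_eq_true, if_false, add_zero]
  rcases floor_child n (x 0) with h | h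
  · rw [h]
    by_cases hk : ⌊x 0 * 2 ^ n⌋ = k 0
    · simp [hk]
    · have h1 : ¬ (2 * ⌊x 0 * 2 ^ n⌋ = 2 * k 0 + 1) := by omega
      simp [hk, h1]
  · rw [h]
    by_cases hk : ⌊x 0 * 2 ^ n⌋ = k 0
    · simp [hk]
    · have h1 : ¬ (2 * ⌊x 0 * 2 ^ n⌋ + 1 = 2 * k 0) := by omega
      simp [hk, h1]

/-- A dyadic interval of generation larger than `K` which meets `[2⁻ᴷ⁻¹, 2⁻ᴷ)` is contained
in it. -/
lemma dyadicIco_subset_of_mem {n k : ℤ} {K : ℕ} {x : ℝ} (hn : (K:ℤ) < n)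
    (hx : x ∈ Ico ((2:ℝ) ^ (-((K:ℤ) + 1))) (2 ^ (-(K:ℤ)))) (hxk : x ∈ dyadicIco n k) :
    dyadicIco n k ⊆ Ico ((2:ℝ) ^ (-((K:ℤ) + 1))) (2 ^ (-(K:ℤ))) := by
  obtain ⟨m, rfl⟩ : ∃ m : ℕ, n = K + 1 + m := ⟨(n - (K + 1)).toNat, by omega⟩
  have h2 : (0:ℝ) < 2 ^ ((K:ℤ) + 1 + m) := by positivity
  have e1 : (2:ℝ) ^ (-((K:ℤ) + 1)) * 2 ^ ((K:ℤ) + 1 + m) = (((2:ℤ) ^ m : ℤ) : ℝ) := by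
    rw [← zpow_add₀ (by norm_num)]
    have : -((K:ℤ) + 1) + (K + 1 + m) = m := by ring
    rw [this]
    simp
  have e2 : (2:ℝ) ^ (-(K:ℤ)) * 2 ^ ((K:ℤ) + 1 + m) = (((2:ℤ) ^ (m + 1) : ℤ) : ℝ) := by
    rw [← zpow_add₀ (by norm_num)]
    have : -(K:ℤ) + (K + 1 + m) = ((m + 1 : ℕ) : ℤ) := by push_cast; ring
    rw [this, zpow_natCast]
    simp
  have key : ∀ y : ℝ, y ∈ Ico ((2:ℝ) ^ (-((K:ℤ) + 1))) (2 ^ (-(K:ℤ))) ↔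
      ⌊y * 2 ^ ((K:ℤ) + 1 + m)⌋ ∈ Ico ((2:ℤ) ^ m) (2 ^ (m + 1)) := by
    intro y
    rw [mem_Ico, mem_Ico, Int.le_floor, Int.floor_lt, ← e1, ← e2,
      mul_le_mul_iff_left₀ h2, mul_lt_mul_iff_left₀ h2]
  intro y hy
  rw [mem_dyadicIco] at hxk hy
  rw [key] at hx ⊢
  rwa [hy, ← hxk]

lemma dyadicAvg_of_eqOn_const {g : ℝ → ℝ} {n k : ℤ} {c : ℝ}
    (h : ∀ t ∈ dyadicIco n k, g t = c) : dyadicAvg g n k = c := by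
  have h1 : ∫ t in dyadicIco n k, g t = ∫ t in dyadicIco n k, c :=
    setIntegral_congr_fun measurableSet_Ico h
  have h2 : (0:ℝ) < 2 ^ (-n) := by positivity
  rw [dyadicAvg, h1, dyadicIco, setIntegral_const, Real.volume_real_Ico_of_le (by gcongr; simp),
    add_mul, add_sub_cancel_left, one_mul, smul_eq_mul, ← mul_assoc, ← zpow_add₀ (by norm_num)]
  simp

/-- The average over `[0, 2⁻ⁿ)` is the mean of the averages over the two halves. -/
lemma dyadicAvg_zero_succ {g : ℝ → ℝ} {c : ℕ → ℝ} (hgi : Integrable g)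
    (hc : ∀ k : ℕ, ∀ t ∈ Ico ((2:ℝ) ^ (-((k:ℤ) + 1))) (2 ^ (-(k:ℤ))), g t = c k) (n : ℕ) :
    dyadicAvg g (n + 1) 0 = 2 * dyadicAvg g n 0 - c n := by
  have hpos : (0:ℝ) < 2 ^ (-((n:ℤ) + 1)) := by positivity
  have hle : (2:ℝ) ^ (-((n:ℤ) + 1)) ≤ 2 ^ (-(n:ℤ)) :=
    zpow_le_zpow_right₀ (by norm_num) (by omega)
  have h1 : ∫ t in Ico (0:ℝ) (2 ^ (-(n:ℤ))), g t =
      (∫ t in Ico (0:ℝ) (2 ^ (-((n:ℤ) + 1))), g t) +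
        ∫ t in Ico ((2:ℝ) ^ (-((n:ℤ) + 1))) (2 ^ (-(n:ℤ))), g t := by
    rw [← Ico_union_Ico_eq_Ico hpos.le hle]
    refine setIntegral_union ?_ measurableSet_Ico hgi.integrableOn hgi.integrableOn
    exact Ico_disjoint_Ico_same
  have h2 : ∫ t in Ico ((2:ℝ) ^ (-((n:ℤ) + 1))) (2 ^ (-(n:ℤ))), g t =
      2 ^ (-((n:ℤ) + 1)) * c n := by
    rw [setIntegral_congr_fun measurableSet_Ico (hc n), setIntegral_const,
      Real.volume_real_Ico_of_le hle, smul_eq_mul]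
    congr 1
    have : -(n:ℤ) = -((n:ℤ) + 1) + 1 := by ring
    rw [this, zpow_add_one₀ (by norm_num)]
    ring
  have e : (2:ℝ) ^ ((n:ℤ) + 1) * 2 ^ (-((n:ℤ) + 1)) = 1 := by
    rw [← zpow_add₀ (by norm_num)]; simp
  have e2 : (2:ℝ) ^ ((n:ℤ) + 1) = 2 * 2 ^ (n:ℤ) := by
    rw [zpow_add_one₀ (by norm_num)]; ring
  rw [dyadicAvg, dyadicAvg, dyadicIco_zero, dyadicIco_zero, h1, h2]
  rw [e2] at e ⊢
  linear_combination (-(c n)) * e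

lemma dyadicAvg_zero_of_nonpos {g : ℝ → ℝ} (hg0 : ∀ t ∉ Ioo (0:ℝ) 1, g t = 0) {n : ℤ}
    (hn : n ≤ 0) : dyadicAvg g n 0 = 2 ^ n * ∫ t, g t := by
  rw [dyadicAvg, dyadicIco_zero]
  congr 1
  refine setIntegral_eq_integral_of_forall_compl_eq_zero fun t ht => hg0 t fun h => ht ?_
  exact ⟨h.1.le, h.2.trans_le (one_le_zpow₀ (by norm_num) (by omega))⟩

/-- Lower bound for the square function of a function that is constant on each interval
`[2⁻ᵏ⁻¹, 2⁻ᵏ)` and supported in the unit interval. -/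
lemma sum_sq_le_sqFnD_sq {g : ℝ → ℝ} {c : ℕ → ℝ} (hgi : Integrable g)
    (hg0 : ∀ t ∉ Ioo (0:ℝ) 1, g t = 0)
    (hc : ∀ k : ℕ, ∀ t ∈ Ico ((2:ℝ) ^ (-((k:ℤ) + 1))) (2 ^ (-(k:ℤ))), g t = c k)
    {K : ℕ} {x : Fin 1 → ℝ} (hx : x 0 ∈ Ico ((2:ℝ) ^ (-((K:ℤ) + 1))) (2 ^ (-(K:ℤ)))) :
    ∑ n ∈ Finset.range (K + 1), (dyadicAvg g n 0 - c n) ^ 2 ≤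
      (sqFnD 1 (fun y => g (y 0)) x) ^ 2 := by
  classical
  have hxpos : 0 < x 0 := lt_of_lt_of_le (by positivity) hx.1
  have hx0 : ∀ n : ℤ, n ≤ K → x 0 ∈ dyadicIco n 0 := by
    intro n hn
    rw [dyadicIco_zero]
    exact ⟨hxpos.le, hx.2.trans_le (zpow_le_zpow_right₀ (by norm_num) (by omega))⟩
  set F : ℤ × (Fin 1 → ℤ) → ℝ := fun q => (deltaCube 1 (fun y => g (y 0)) q.1 q.2 x) ^ 2 with hF
  let ι : ℕ → ℤ × (Fin 1 → ℤ) := fun j => ((K:ℤ) - j, fun _ => 0)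
  have hι : Function.Injective ι := by
    intro i j hij
    have := congrArg Prod.fst hij
    simp only [ι] at this
    omega
  have hsupp : ∀ q ∉ range ι, F q = 0 := by
    rintro ⟨n, k⟩ hq
    simp only [hF]
    rw [deltaCube_one]
    split_ifs with hmem
    · rcases le_or_gt n K with hn | hn
      · exfalso
        apply hq
        have hk : k 0 = 0 := by
          rw [← mem_dyadicIco.mp hmem, mem_dyadicIco.mp (hx0 n hn)]
        refine ⟨(K - n).toNat, ?_⟩
        simp only [ι, Prod.mk.injEq]
        refine ⟨by omega, ?_⟩
        funext i
        rw [Fin.fin_one_eq_zero i, hk]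
      · rw [dyadicAvg_of_eqOn_const (c := c K) fun t ht =>
            hc K t (dyadicIco_subset_of_mem hn hx hmem ht),
          dyadicAvg_of_eqOn_const (c := c K) fun t ht =>
            hc K t (dyadicIco_subset_of_mem (by omega) hx (mem_dyadicIco.mpr rfl) ht)]
        simp
    · simp
  have hleft : ∀ n : ℤ, n < K → F (n, fun _ => 0) =
      (dyadicAvg g (n + 1) 0 - dyadicAvg g n 0) ^ 2 := by
    intro n hn
    simp only [hF]
    rw [deltaCube_one, if_pos (hx0 n hn.le), mem_dyadicIco.mp (hx0 (n + 1) (by omega))]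
  have hright : F ((K:ℤ), fun _ => 0) = (c K - dyadicAvg g K 0) ^ 2 := by
    simp only [hF]
    rw [deltaCube_one, if_pos (hx0 K le_rfl), dyadicAvg_of_eqOn_const (c := c K) fun t ht =>
      hc K t (dyadicIco_subset_of_mem (by omega) hx (mem_dyadicIco.mpr rfl) ht)]
  have hval : ∀ n ∈ Finset.range (K + 1),
      F ((n:ℤ), fun _ => 0) = (dyadicAvg g n 0 - c n) ^ 2 := by
    intro n hn
    rw [Finset.mem_range] at hn
    rcases (Nat.lt_succ_iff.mp hn).lt_or_eq with h | h
    · rw [hleft n (by exact_mod_cast h), dyadicAvg_zero_succ hgi hc]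
      ring
    · rw [h, hright]
      ring
  have hsum : Summable F := by
    rw [← hι.summable_iff hsupp, ← summable_nat_add_iff (K + 1)]
    have hgeo : Summable fun l : ℕ => (∫ t, g t) ^ 2 / 4 * (1 / 4 : ℝ) ^ l :=
      (summable_geometric_of_lt_one (by norm_num) (by norm_num)).mul_left _
    refine hgeo.congr fun l => ?_
    simp only [Function.comp, ι]
    have e : (K:ℤ) - ((l + (K + 1) : ℕ) : ℤ) = -((l:ℤ) + 1) := by push_cast; ring
    rw [e, hleft _ (by omega), dyadicAvg_zero_of_nonpos hg0 (by omega),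
      dyadicAvg_zero_of_nonpos hg0 (by omega), zpow_add_one₀ (by norm_num), zpow_neg,
      zpow_add_one₀ (by norm_num), zpow_natCast, one_div, inv_pow,
      show (4:ℝ) = 2 ^ 2 by norm_num, ← pow_mul, mul_comm 2 l, pow_mul]
    field_simp
    ring
  have hnn : ∀ q, 0 ≤ F q := fun q => sq_nonneg _
  rw [sqFnD, Real.sq_sqrt (tsum_nonneg hnn)]
  have hinj : Function.Injective fun n : ℕ => (((n:ℤ), fun _ => 0) : ℤ × (Fin 1 → ℤ)) := by
    intro i j hij
    have := congrArg Prod.fst hij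
    simpa using this
  calc _ = ∑ n ∈ Finset.range (K + 1), F ((n:ℤ), fun _ => 0) :=
        (Finset.sum_congr rfl hval).symm
    _ = ∑ q ∈ (Finset.range (K + 1)).map ⟨_, hinj⟩, F q := by
        rw [Finset.sum_map]; rfl
    _ ≤ ∑' q, F q := hsum.sum_le_tsum _ fun q _ => hnn q

end SquareFunction

section TestFunctions

/-- The function on `(0,1)` with value `c (-(k+1))` on `[2⁻ᵏ⁻¹, 2⁻ᵏ)`, extended by zero. -/
def dyadicStep (c : ℤ → ℝ) : ℝ → ℝ :=
  (Ioo (0:ℝ) 1).indicator fun t => c ⌊Real.logb 2 t⌋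

lemma measurable_dyadicStep (c : ℤ → ℝ) : Measurable (dyadicStep c) := by
  refine Measurable.indicator ?_ measurableSet_Ioo
  exact (measurable_of_countable c).comp
    (Int.measurable_floor.comp (by unfold Real.logb; fun_prop))

lemma dyadicStep_of_notMem (c : ℤ → ℝ) : ∀ t ∉ Ioo (0:ℝ) 1, dyadicStep c t = 0 :=
  fun _ ht => indicator_of_notMem ht _

lemma zpow_floor_logb_le {t : ℝ} (ht : 0 < t) : (2:ℝ) ^ ⌊Real.logb 2 t⌋ ≤ t := by
  have h := Int.floor_le (Real.logb 2 t)
  rwa [Real.le_logb_iff_rpow_le (by norm_num) ht, Real.rpow_intCast] at h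

lemma lt_two_mul_zpow_floor_logb {t : ℝ} (ht : 0 < t) : t < 2 * (2:ℝ) ^ ⌊Real.logb 2 t⌋ := by
  have h := Int.lt_floor_add_one (Real.logb 2 t)
  rw [Real.logb_lt_iff_lt_rpow (by norm_num) ht, Real.rpow_add_one (by norm_num),
    Real.rpow_intCast] at h
  linarith

lemma floor_logb_eq {t : ℝ} {k : ℕ} (ht : t ∈ Ico ((2:ℝ) ^ (-((k:ℤ) + 1))) (2 ^ (-(k:ℤ)))) :
    ⌊Real.logb 2 t⌋ = -((k:ℤ) + 1) := by
  have ht0 : 0 < t := lt_of_lt_of_le (by positivity) ht.1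
  have h1 := (zpow_floor_logb_le ht0).trans_lt ht.2
  have h2 := ht.1.trans_lt (lt_two_mul_zpow_floor_logb ht0)
  rw [mul_comm, ← zpow_add_one₀ (by norm_num)] at h2
  rw [zpow_lt_zpow_iff_right₀ (by norm_num)] at h1 h2
  omega

lemma dyadicStep_of_mem (c : ℤ → ℝ) (k : ℕ) :
    ∀ t ∈ Ico ((2:ℝ) ^ (-((k:ℤ) + 1))) (2 ^ (-(k:ℤ))), dyadicStep c t = c (-((k:ℤ) + 1)) := by
  intro t ht
  have h : t ∈ Ioo (0:ℝ) 1 :=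
    ⟨lt_of_lt_of_le (by positivity) ht.1,
      ht.2.trans_le (zpow_le_one_of_nonpos₀ (by norm_num) (by omega))⟩
  rw [dyadicStep, indicator_of_mem h, floor_logb_eq ht]

lemma exists_mem_layer {t : ℝ} (ht : t ∈ Ioo (0:ℝ) 1) :
    ∃ K : ℕ, t ∈ Ico ((2:ℝ) ^ (-((K:ℤ) + 1))) (2 ^ (-(K:ℤ))) := by
  have h1 := zpow_floor_logb_le ht.1
  have h2 := lt_two_mul_zpow_floor_logb ht.1
  set n := ⌊Real.logb 2 t⌋
  have hn : n < 0 := by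
    have : (2:ℝ) ^ n < 2 ^ (0:ℤ) := by simpa using h1.trans_lt ht.2
    rwa [zpow_lt_zpow_iff_right₀ (by norm_num)] at this
  refine ⟨(-n - 1).toNat, ?_⟩
  have e : (((-n - 1).toNat : ℕ) : ℤ) = -n - 1 := by omega
  rw [e, show -(-n - 1 + 1) = n by ring, show -(-n - 1) = n + 1 by ring,
    zpow_add_one₀ (by norm_num)]
  exact ⟨h1, by linarith⟩

lemma dyadicStep_div_mul_abs_rpow (c : ℤ → ℝ) (r : ℝ) :
    (fun y : Fin 1 → ℝ => dyadicStep c (y 0) / |y 0| ^ r * |y 0| ^ r) =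
      fun y => dyadicStep c (y 0) := by
  funext y
  by_cases h : y 0 = 0
  · rw [dyadicStep_of_notMem c (y 0) (by simp [h])]
    simp
  · exact div_mul_cancel₀ _ (Real.rpow_pos_of_pos (abs_pos.mpr h) _).ne'

lemma lintegral_rpow_Ioo {δ b M : ℝ} (hδ : 0 < δ) (hb : 0 ≤ b) (hM : 0 ≤ M) :
    ∫⁻ t in Ioo 0 b, ENNReal.ofReal (M * t ^ (δ - 1)) = ENNReal.ofReal (M * (b ^ δ / δ)) := by
  have hgi : IntegrableOn (fun t : ℝ => t ^ (δ - 1)) (Ioo 0 b) := by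
    refine ((integrable_abs_rpow_Ico (by linarith : -1 < δ - 1) 0 b).mono_set
      Ioo_subset_Ico_self).congr_fun (fun t ht => ?_) measurableSet_Ioo
    simp [abs_of_pos ht.1]
  rw [← ofReal_integral_eq_lintegral_ofReal (hgi.const_mul M)]
  · rw [integral_const_mul, ← integral_Ico_eq_integral_Ioo,
      setIntegral_rpow_Ico_zero (by linarith) hb]
    simp
  · filter_upwards [ae_restrict_mem measurableSet_Ioo] with t ht
    exact mul_nonneg hM (Real.rpow_nonneg ht.1.le _)

lemma le_pNormD_one {p δ b M : ℝ} (hp : 0 < p) (hδ : 0 < δ) (hb : 0 ≤ b) (hM : 0 ≤ M)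
    {F w : (Fin 1 → ℝ) → ℝ}
    (h : ∀ x : Fin 1 → ℝ, x 0 ∈ Ioo 0 b → M * (x 0) ^ (δ - 1) ≤ |F x| ^ p * w x) :
    ENNReal.ofReal ((M * (b ^ δ / δ)) ^ (1 / p)) ≤ pNormD 1 p F w := by
  rw [pNormD, ← ENNReal.ofReal_rpow_of_nonneg (by positivity) (by positivity)]
  refine ENNReal.rpow_le_rpow ?_ (by positivity)
  rw [← lintegral_rpow_Ioo hδ hb hM, ← lintegral_indicator measurableSet_Ioo,
    ← lintegral_fin_one]
  refine lintegral_mono fun x => ?_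
  by_cases hx : x 0 ∈ Ioo 0 b
  · rw [indicator_of_mem hx]
    exact ENNReal.ofReal_le_ofReal (h x hx)
  · rw [indicator_of_notMem hx]
    exact zero_le

lemma pNormD_one_le {p δ b M : ℝ} (hp : 0 < p) (hδ : 0 < δ) (hb : 0 ≤ b) (hM : 0 ≤ M)
    {F w : (Fin 1 → ℝ) → ℝ} (h0 : ∀ x : Fin 1 → ℝ, x 0 ∉ Ioo 0 b → F x = 0)
    (h : ∀ x : Fin 1 → ℝ, x 0 ∈ Ioo 0 b → |F x| ^ p * w x ≤ M * (x 0) ^ (δ - 1)) :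
    pNormD 1 p F w ≤ ENNReal.ofReal ((M * (b ^ δ / δ)) ^ (1 / p)) := by
  rw [pNormD, ← ENNReal.ofReal_rpow_of_nonneg (by positivity) (by positivity)]
  refine ENNReal.rpow_le_rpow ?_ (by positivity)
  rw [← lintegral_rpow_Ioo hδ hb hM, ← lintegral_indicator measurableSet_Ioo,
    ← lintegral_fin_one]
  refine lintegral_mono fun x => ?_
  by_cases hx : x 0 ∈ Ioo 0 b
  · rw [indicator_of_mem hx]
    exact ENNReal.ofReal_le_ofReal (h x hx)
  · simp [h0 x hx, Real.zero_rpow hp.ne']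

lemma half_rpow_sub_one_le {δ b : ℝ} (hδ : 0 ≤ δ) (hb : 0 < b) :
    (b / 2) ^ (δ - 1) ≤ 2 * b ^ (δ - 1) := by
  have h1 : (2:ℝ) ^ (1 - δ) ≤ 2 := by
    calc (2:ℝ) ^ (1 - δ) ≤ 2 ^ (1:ℝ) :=
          Real.rpow_le_rpow_of_exponent_le (by norm_num) (by linarith)
      _ = 2 := by norm_num
  have h2 : (b / 2) ^ (δ - 1) = 2 ^ (1 - δ) * b ^ (δ - 1) := by
    rw [Real.div_rpow hb.le (by norm_num), show (1 - δ) = -(δ - 1) by ring,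
      Real.rpow_neg (by norm_num)]
    field_simp
  rw [h2]
  gcongr

lemma le_dyadicStep_singular {δ t : ℝ} (hδ1 : δ ≤ 1) (ht : t ∈ Ioo (0:ℝ) 1) :
    t ^ (δ - 1) ≤ dyadicStep (fun n => ((2:ℝ) ^ n) ^ (δ - 1)) t := by
  rw [dyadicStep, indicator_of_mem ht]
  exact Real.rpow_le_rpow_of_nonpos (by positivity) (zpow_floor_logb_le ht.1) (by linarith)

lemma dyadicStep_singular_le {δ t : ℝ} (hδ : 0 ≤ δ) (hδ1 : δ ≤ 1) (ht : t ∈ Ioo (0:ℝ) 1) :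
    dyadicStep (fun n => ((2:ℝ) ^ n) ^ (δ - 1)) t ≤ 2 * t ^ (δ - 1) := by
  rw [dyadicStep, indicator_of_mem ht]
  refine le_trans ?_ (half_rpow_sub_one_le hδ ht.1)
  have := lt_two_mul_zpow_floor_logb ht.1
  exact Real.rpow_le_rpow_of_nonpos (by linarith [ht.1]) (by linarith) (by linarith)

/-- Pointwise lower bound for the square function of a step version of `t^(δ-1)` on `(0,1)`. -/
lemma le_sqFnD_singular {δ : ℝ} (hδ : 0 < δ) (hδ4 : δ ≤ 1 / 4) {x : Fin 1 → ℝ}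
    (hx : x 0 ∈ Ioo (0:ℝ) 1) :
    1 / (4 * δ) * (x 0) ^ (δ - 1) ≤
      sqFnD 1 (fun y => dyadicStep (fun n => ((2:ℝ) ^ n) ^ (δ - 1)) (y 0)) x := by
  set c : ℤ → ℝ := fun n => ((2:ℝ) ^ n) ^ (δ - 1) with hcdef
  set g := dyadicStep c with hg
  have hlow : ∀ t ∈ Ioo (0:ℝ) 1, t ^ (δ - 1) ≤ g t := fun t ht =>
    le_dyadicStep_singular (by linarith) ht
  have hupp : ∀ t ∈ Ioo (0:ℝ) 1, g t ≤ 2 * t ^ (δ - 1) := fun t ht =>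
    dyadicStep_singular_le hδ.le (by linarith) ht
  have hgi : Integrable g := by
    have h1 : IntegrableOn g (Ico 0 1) := by
      refine Integrable.mono' ((integrable_abs_rpow_Ico (by linarith : -1 < δ - 1) 0 1).const_mul 2)
        (measurable_dyadicStep c).aestronglyMeasurable ?_
      refine Eventually.of_forall fun t => ?_
      by_cases ht : t ∈ Ioo (0:ℝ) 1
      · have h3 := Real.rpow_nonneg ht.1.le (δ - 1)
        rw [Real.norm_of_nonneg (h3.trans (hlow t ht)), abs_of_pos ht.1]
        exact hupp t ht
      · rw [hg, dyadicStep_of_notMem c t ht]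
        simp only [norm_zero]
        positivity
    rw [← integrableOn_univ]
    refine h1.of_forall_sdiff_eq_zero MeasurableSet.univ fun t ht => ?_
    exact dyadicStep_of_notMem c t fun h => ht.2 ⟨h.1.le, h.2⟩
  obtain ⟨K, hK⟩ := exists_mem_layer hx
  have hS := sum_sq_le_sqFnD_sq hgi (dyadicStep_of_notMem c)
    (c := fun k => c (-((k:ℤ) + 1))) (dyadicStep_of_mem c) hK
  have hS2 : (dyadicAvg g K 0 - c (-((K:ℤ) + 1))) ^ 2 ≤ (sqFnD 1 (fun y => g (y 0)) x) ^ 2 :=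
    le_trans (Finset.single_le_sum
      (f := fun n : ℕ => (dyadicAvg g n 0 - c (-((n:ℤ) + 1))) ^ 2) (fun _ _ => sq_nonneg _)
      (Finset.mem_range.mpr (Nat.lt_succ_self K))) hS
  have hS3 := abs_le_of_sq_le_sq' hS2 (Real.sqrt_nonneg _)
  refine le_trans ?_ hS3.2
  set b : ℝ := 2 ^ (-(K:ℤ)) with hb
  have hbpos : 0 < b := by positivity
  have hb1 : b ≤ 1 := zpow_le_one_of_nonpos₀ (by norm_num) (by omega)
  have hbx : b / 2 ≤ x 0 := by
    have := hK.1
    rwa [show -((K:ℤ) + 1) = -(K:ℤ) - 1 by ring, zpow_sub_one₀ (by norm_num),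
      ← div_eq_mul_inv] at this
  have havg : b ^ (δ - 1) / δ ≤ dyadicAvg g K 0 := by
    have h1 : b ^ δ / δ ≤ ∫ t in Ico 0 b, g t := by
      have h2 := setIntegral_rpow_Ico_zero (r := δ - 1) (by linarith) hbpos.le
      rw [sub_add_cancel] at h2
      rw [← h2]
      have hi : IntegrableOn (fun t : ℝ => t ^ (δ - 1)) (Ico 0 b) := by
        refine (integrable_abs_rpow_Ico (by linarith : -1 < δ - 1) 0 b).congr_fun
          (fun t ht => ?_) measurableSet_Ico
        simp [abs_of_nonneg ht.1]
      refine setIntegral_mono_on hi hgi.integrableOn measurableSet_Ico fun t ht => ?_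
      rcases ht.1.eq_or_lt with h3 | h3
      · rw [← h3, Real.zero_rpow (by linarith), hg, dyadicStep_of_notMem c 0 (by simp)]
      · exact hlow t ⟨h3, ht.2.trans_le hb1⟩
    have h2 : (2:ℝ) ^ (K:ℤ) = b⁻¹ := by rw [hb, zpow_neg, inv_inv]
    rw [dyadicAvg, dyadicIco_zero, ← hb, h2, Real.rpow_sub_one hbpos.ne']
    calc b ^ δ / b / δ = b⁻¹ * (b ^ δ / δ) := by ring
      _ ≤ _ := by gcongr
  have hcK : c (-((K:ℤ) + 1)) ≤ 2 * b ^ (δ - 1) := by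
    have : c (-((K:ℤ) + 1)) = (b / 2) ^ (δ - 1) := by
      simp only [hcdef, hb]
      rw [show -((K:ℤ) + 1) = -(K:ℤ) - 1 by ring, zpow_sub_one₀ (by norm_num),
        ← div_eq_mul_inv]
    rw [this]
    exact half_rpow_sub_one_le hδ.le hbpos
  have hxb : (x 0) ^ (δ - 1) ≤ 2 * b ^ (δ - 1) :=
    (Real.rpow_le_rpow_of_nonpos (by positivity) hbx (by linarith)).trans
      (half_rpow_sub_one_le hδ.le hbpos)
  have hbp : 0 < b ^ (δ - 1) := Real.rpow_pos_of_pos hbpos _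
  have hδ2 : 2 ≤ 1 / (2 * δ) := by
    rw [le_div_iff₀ (by positivity)]; linarith
  calc 1 / (4 * δ) * (x 0) ^ (δ - 1) ≤ 1 / (4 * δ) * (2 * b ^ (δ - 1)) := by gcongr
    _ = b ^ (δ - 1) / δ - 1 / (2 * δ) * b ^ (δ - 1) := by field_simp; ring
    _ ≤ b ^ (δ - 1) / δ - 2 * b ^ (δ - 1) := by gcongr
    _ ≤ _ := by linarith

/-- Pointwise lower bound for the square function of the alternating step function. -/
lemma le_sqFnD_alternating {N : ℕ} {x : Fin 1 → ℝ}
    (hx : x 0 ∈ Ioo (0:ℝ) (2 ^ (-(N:ℤ)))) :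
    √N / 2 ≤ sqFnD 1 (fun y => dyadicStep (fun n => (-1:ℝ) ^ n) (y 0)) x := by
  set c : ℤ → ℝ := fun n => (-1:ℝ) ^ n with hcdef
  set g := dyadicStep c with hg
  have hc1 : ∀ n, |c n| = 1 := fun n => by simp [hcdef, abs_zpow]
  have hcsucc : ∀ n : ℕ, c (-(((n + 1 : ℕ) : ℤ) + 1)) = -c (-((n:ℤ) + 1)) := by
    intro n
    simp only [hcdef]
    rw [show -(((n + 1 : ℕ) : ℤ) + 1) = -((n:ℤ) + 1) - 1 by push_cast; ring,
      zpow_sub_one₀ (by norm_num)]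
    norm_num
  have hg1 : ∀ t, ‖g t‖ ≤ 1 := by
    intro t
    by_cases ht : t ∈ Ioo (0:ℝ) 1
    · rw [hg, dyadicStep, indicator_of_mem ht, Real.norm_eq_abs, hc1]
    · rw [hg, dyadicStep_of_notMem c t ht]
      simp
  have hgi : Integrable g := by
    rw [hg, dyadicStep, integrable_indicator_iff measurableSet_Ioo]
    have h1 : IntegrableOn g (Ioo 0 1) :=
      Measure.integrableOn_of_bounded (M := 1) (by simp)
        (measurable_dyadicStep c).aestronglyMeasurable (Eventually.of_forall hg1)
    refine h1.congr_fun (fun t ht => ?_) measurableSet_Ioo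
    rw [hg, dyadicStep, indicator_of_mem ht]
  have havg : ∀ n : ℕ, |dyadicAvg g n 0| ≤ 1 := by
    intro n
    have hpos : (0:ℝ) < 2 ^ (-(n:ℤ)) := by positivity
    have h1 := norm_setIntegral_le_of_norm_le_const (μ := volume) (f := g)
      (s := Ico 0 ((2:ℝ) ^ (-(n:ℤ)))) (C := 1) measure_Ico_lt_top fun t _ => hg1 t
    rw [Real.volume_real_Ico_of_le hpos.le, one_mul, sub_zero, Real.norm_eq_abs] at h1
    rw [dyadicAvg, dyadicIco_zero, abs_mul, abs_of_pos (zpow_pos (by norm_num) _)]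
    calc _ ≤ (2:ℝ) ^ (n:ℤ) * 2 ^ (-(n:ℤ)) := by gcongr
      _ = 1 := by rw [← zpow_add₀ (by norm_num)]; simp
  have hterm : ∀ n : ℕ, 1 / 4 ≤ (dyadicAvg g n 0 - c (-((n:ℤ) + 1))) ^ 2 := by
    intro n
    have e1 := dyadicAvg_zero_succ hgi (c := fun k => c (-((k:ℤ) + 1))) (dyadicStep_of_mem c) n
    have e2 := dyadicAvg_zero_succ hgi (c := fun k => c (-((k:ℤ) + 1))) (dyadicStep_of_mem c)
      (n + 1)
    rw [hcsucc n] at e2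
    push_cast at e2
    have h2 := havg (n + 2)
    push_cast at h2
    rw [show ((n:ℤ) + 2) = n + 1 + 1 by ring] at h2
    have h3 := abs_le.mp h2
    rcases (abs_eq (by norm_num)).mp (hc1 (-((n:ℤ) + 1))) with h | h <;>
    · rw [h] at e1 e2 ⊢
      nlinarith
  have hx1 : x 0 ∈ Ioo (0:ℝ) 1 :=
    ⟨hx.1, hx.2.trans_le (zpow_le_one_of_nonpos₀ (by norm_num) (by omega))⟩
  obtain ⟨K, hK⟩ := exists_mem_layer hx1
  have hNK : N ≤ K := by
    have := hK.1.trans_lt hx.2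
    rw [zpow_lt_zpow_iff_right₀ (by norm_num)] at this
    omega
  have hS := sum_sq_le_sqFnD_sq hgi (dyadicStep_of_notMem c)
    (c := fun k => c (-((k:ℤ) + 1))) (dyadicStep_of_mem c) hK
  have hS2 : (N:ℝ) / 4 ≤ (sqFnD 1 (fun y => g (y 0)) x) ^ 2 := by
    refine le_trans ?_ hS
    calc (N:ℝ) / 4 ≤ ((K + 1 : ℕ) : ℝ) * (1 / 4) := by
          have : (N:ℝ) ≤ K := by exact_mod_cast hNK
          push_cast
          linarith
      _ = ∑ _n ∈ Finset.range (K + 1), (1 / 4 : ℝ) := by simp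
      _ ≤ _ := Finset.sum_le_sum fun n _ => hterm n
  refine le_trans (Real.le_sqrt_of_sq_le ?_) (Real.sqrt_sq (Real.sqrt_nonneg _)).le
  rw [div_pow, Real.sq_sqrt (by positivity)]
  exact le_of_eq_of_le (by norm_num) hS2

end TestFunctions

section Sharpness

/-- The two-weight bound for the dyadic square function on the line with constant `C`. -/
def SqFnBound (p C : ℝ) (φ ψ : ℝ → ℝ) : Prop :=
  ∀ w σ : (Fin 1 → ℝ) → ℝ, IsWeightD 1 w → IsWeightD 1 σ →
    ainfCharD 1 σ < ⊤ → ainfCharD 1 w < ⊤ →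
    ∀ f : (Fin 1 → ℝ) → ℝ, Measurable f →
      pNormD 1 p (sqFnD 1 (fun y => f y * σ y)) w ≤
        ENNReal.ofReal C * (apCharD 1 p w σ) ^ (1/p) *
          ENNReal.ofReal (φ ((ainfCharD 1 w).toReal) + ψ ((ainfCharD 1 σ).toReal)) *
          pNormD 1 p f σ

/-- The two-weight bound for power weights, with all the quantities replaced by real bounds. -/
lemma SqFnBound.real_bound {p C : ℝ} {φ ψ : ℝ → ℝ} (HC : SqFnBound p C φ ψ) (hp : 0 < p)
    (hC : 0 ≤ C) (hφmono : MonotoneOn φ (Set.Ici 1)) (hψmono : MonotoneOn ψ (Set.Ici 1))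
    {r s X Y W u v : ℝ} (hr : -1 < r) (hs : -1 < s) (hY : 0 ≤ Y) (hW : 0 ≤ W)
    (hZ : 0 ≤ φ u + ψ v)
    (hw : ainfCharD 1 (fun x => |x 0| ^ r) ≤ ENNReal.ofReal u)
    (hσ : ainfCharD 1 (fun x => |x 0| ^ s) ≤ ENNReal.ofReal v)
    (hap : apCharD 1 p (fun x => |x 0| ^ r) (fun x => |x 0| ^ s) ≤ ENNReal.ofReal Y)
    (c : ℤ → ℝ)
    (hX : ENNReal.ofReal X ≤
      pNormD 1 p (sqFnD 1 (fun y => dyadicStep c (y 0))) (fun x => |x 0| ^ r))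
    (hf : pNormD 1 p (fun y => dyadicStep c (y 0) / |y 0| ^ s) (fun x => |x 0| ^ s) ≤
      ENNReal.ofReal W) :
    X ≤ C * Y ^ (1 / p) * (φ u + ψ v) * W := by
  have toReal_bounds : ∀ {q z : ℝ}, -1 < q →
      ainfCharD 1 (fun x => |x 0| ^ q) ≤ ENNReal.ofReal z →
      1 ≤ (ainfCharD 1 (fun x => |x 0| ^ q)).toReal ∧
        (ainfCharD 1 (fun x => |x 0| ^ q)).toReal ≤ z := by
    intro q z hq hz
    have h1 := one_le_ainfCharD_abs_rpow hq
    have hz1 : 1 ≤ z := by simpa using h1.trans hz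
    exact ⟨by simpa using ENNReal.toReal_mono (hz.trans_lt ENNReal.ofReal_lt_top).ne h1,
      ENNReal.toReal_le_of_le_ofReal (by linarith) hz⟩
  have hu := toReal_bounds hr hw
  have hv := toReal_bounds hs hσ
  have hmeas : Measurable fun y : Fin 1 → ℝ => dyadicStep c (y 0) / |y 0| ^ s :=
    ((measurable_dyadicStep c).comp (measurable_pi_apply 0)).div (by fun_prop)
  have h := HC _ _ (isWeightD_abs_rpow hr) (isWeightD_abs_rpow hs)
    (hσ.trans_lt ENNReal.ofReal_lt_top) (hw.trans_lt ENNReal.ofReal_lt_top) _ hmeas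
  rw [dyadicStep_div_mul_abs_rpow] at h
  have hφu := hφmono (mem_Ici.mpr hu.1) (mem_Ici.mpr (hu.1.trans hu.2)) hu.2
  have hψv := hψmono (mem_Ici.mpr hv.1) (mem_Ici.mpr (hv.1.trans hv.2)) hv.2
  rw [← ENNReal.ofReal_le_ofReal_iff (by positivity)]
  calc ENNReal.ofReal X ≤ _ := hX
    _ ≤ _ := h
    _ ≤ ENNReal.ofReal C * (ENNReal.ofReal Y) ^ (1 / p) * ENNReal.ofReal (φ u + ψ v) *
          ENNReal.ofReal W := by gcongr
    _ = _ := by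
        rw [ENNReal.ofReal_rpow_of_nonneg hY (by positivity), ← ENNReal.ofReal_mul hC,
          ← ENNReal.ofReal_mul (by positivity), ← ENNReal.ofReal_mul (by positivity)]

lemma rpow_le_of_sqFnD_bound_singular {p C : ℝ} {φ ψ : ℝ → ℝ} (hp0 : 0 < p) (hp1 : 0 < p - 1)
    (hφmono : MonotoneOn φ (Set.Ici 1)) (hψmono : MonotoneOn ψ (Set.Ici 1))
    (hφmaps : ∀ x : ℝ, 1 ≤ x → 1 ≤ φ x) (hψmaps : ∀ x : ℝ, 1 ≤ x → 1 ≤ ψ x)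
    (hC : 0 ≤ C) (HC : SqFnBound p C φ ψ) {y : ℝ} (hy : 16 ≤ y) :
    y ^ (1 / p) ≤ 32 * C * (φ (4 * 2 ^ (p - 1)) + ψ y) := by
  set δ : ℝ := 4 / y with hδdef
  have hy0 : 0 < y := by linarith
  have hδ : 0 < δ := by positivity
  have hδ4 : δ ≤ 1 / 4 := by rw [hδdef, div_le_iff₀ hy0]; linarith
  have hyδ : 4 / δ = y := by rw [hδdef]; field_simp
  have h2p := Real.one_le_rpow (by norm_num : (1:ℝ) ≤ 2) hp1.le
  have hZ1 := hφmaps (4 * 2 ^ (p - 1)) (by linarith)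
  have hZ2 := hψmaps y (by linarith)
  have hexp : 0 ≤ (1 - δ) * (p - 1) := mul_nonneg (by linarith) hp1.le
  have hw : ainfCharD 1 (fun x => |x 0| ^ ((1 - δ) * (p - 1))) ≤
      ENNReal.ofReal (4 * 2 ^ (p - 1)) := by
    refine (ainfCharD_abs_rpow_le hexp).trans (ENNReal.ofReal_le_ofReal ?_)
    gcongr
    · norm_num
    · nlinarith
  have hσ : ainfCharD 1 (fun x => |x 0| ^ (δ - 1)) ≤ ENNReal.ofReal y :=
    hyδ ▸ ainfCharD_abs_rpow_neg_le hδ (by linarith)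
  have hap := apCharD_right_singular_le (p := p) (by linarith) hδ (by linarith)
  have hX := le_pNormD_one (p := p) (δ := δ) (b := 1) (M := (1 / (4 * δ)) ^ p)
    (F := sqFnD 1 (fun y => dyadicStep (fun n => ((2:ℝ) ^ n) ^ (δ - 1)) (y 0)))
    (w := fun x => |x 0| ^ ((1 - δ) * (p - 1))) hp0 hδ zero_le_one (by positivity) (by
      intro x hx
      have h1 := le_sqFnD_singular hδ hδ4 hx
      have h2 : 0 ≤ 1 / (4 * δ) * (x 0) ^ (δ - 1) :=
        mul_nonneg (by positivity) (Real.rpow_nonneg hx.1.le _)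
      rw [abs_of_nonneg (h2.trans h1), abs_of_pos hx.1]
      have h3 : (x 0) ^ (δ - 1) =
          ((x 0) ^ (δ - 1)) ^ p * (x 0) ^ ((1 - δ) * (p - 1)) := by
        rw [← Real.rpow_mul hx.1.le, ← Real.rpow_add hx.1]
        ring_nf
      rw [h3, ← mul_assoc, ← Real.mul_rpow (by positivity) (Real.rpow_nonneg hx.1.le _)]
      exact mul_le_mul_of_nonneg_right (Real.rpow_le_rpow h2 h1 hp0.le)
        (Real.rpow_nonneg hx.1.le _))
  have hf := pNormD_one_le (p := p) (δ := δ) (b := 1) (M := 2 ^ p)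
    (F := fun y => dyadicStep (fun n => ((2:ℝ) ^ n) ^ (δ - 1)) (y 0) / |y 0| ^ (δ - 1))
    (w := fun x => |x 0| ^ (δ - 1)) hp0 hδ zero_le_one (by positivity)
    (fun x hx => by simp [dyadicStep_of_notMem _ _ hx]) (by
      intro x hx
      have hpos := Real.rpow_pos_of_pos hx.1 (δ - 1)
      have h1 := dyadicStep_singular_le hδ.le (by linarith) hx
      have h2 := hpos.le.trans (le_dyadicStep_singular (δ := δ) (by linarith) hx)
      simp only [abs_of_pos hx.1]
      rw [abs_of_nonneg (div_nonneg h2 hpos.le)]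
      refine mul_le_mul_of_nonneg_right ?_ hpos.le
      refine Real.rpow_le_rpow (div_nonneg h2 hpos.le) ?_ hp0.le
      rwa [div_le_iff₀ hpos])
  have h := HC.real_bound hp0 hC hφmono hψmono (by linarith) (by linarith) (by positivity)
    (by positivity) (by linarith) hw hσ hap _ hX hf
  have hδp : 0 < (1 / δ) ^ (1 / p) := Real.rpow_pos_of_pos (by positivity) _
  rw [hyδ, Real.one_rpow, Real.mul_rpow (by positivity) (by positivity),
    Real.mul_rpow (by positivity) (by positivity), ← Real.rpow_mul (by positivity),
    ← Real.rpow_mul (by positivity), ← Real.rpow_mul (by positivity), mul_one_div_cancel hp0.ne',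
    Real.rpow_one, Real.rpow_one, ← mul_assoc, mul_le_mul_iff_left₀ hδp] at h
  have h4 : 1 / (4 * δ) = y / 16 := by rw [hδdef]; field_simp; norm_num
  have h5 : y = y ^ (1 / p) * y ^ ((p - 1) * (1 / p)) := by
    rw [← Real.rpow_add hy0]
    have : 1 / p + (p - 1) * (1 / p) = 1 := by field_simp; ring
    rw [this, Real.rpow_one]
  have h6 : 0 < y ^ ((p - 1) * (1 / p)) := Real.rpow_pos_of_pos hy0 _
  rw [h4] at h
  refine le_of_mul_le_mul_right ?_ h6
  calc y ^ (1 / p) * y ^ ((p - 1) * (1 / p)) = 16 * (y / 16) := by rw [← h5]; ring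
    _ ≤ 16 * (C * y ^ ((p - 1) * (1 / p)) * (φ (4 * 2 ^ (p - 1)) + ψ y) * 2) := by gcongr
    _ = _ := by ring

lemma sqrt_le_of_sqFnD_bound_alternating {p C : ℝ} {φ ψ : ℝ → ℝ} (hp : 2 < p)
    (hφmono : MonotoneOn φ (Set.Ici 1)) (hψmono : MonotoneOn ψ (Set.Ici 1))
    (hφmaps : ∀ x : ℝ, 1 ≤ x → 1 ≤ φ x) (hψmaps : ∀ x : ℝ, 1 ≤ x → 1 ≤ ψ x)
    (hC : 0 ≤ C) (HC : SqFnBound p C φ ψ) {N : ℕ} (hN : 1 ≤ N) :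
    √N ≤ 4 * (C * (4 * (N:ℝ)) ^ (1 / p) * (φ (4 * N) + ψ 8)) := by
  have hp0 : 0 < p := by linarith
  have hp1 : 0 < p - 1 := by linarith
  have hN1 : (1:ℝ) ≤ N := by exact_mod_cast hN
  have hN0 : (0:ℝ) < N := by linarith
  set δ : ℝ := 1 / N with hδdef
  have hδ : 0 < δ := by positivity
  have hδ1 : δ ≤ 1 := by rw [hδdef, div_le_one hN0]; exact hN1
  have hNδ : 1 / δ = N := by rw [hδdef]; simp
  have hNδ4 : 4 / δ = 4 * N := by rw [hδdef]; simp
  have hZ1 := hφmaps (4 * N) (by linarith)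
  have hZ2 := hψmaps 8 (by norm_num)
  set s : ℝ := (1 - δ) / (p - 1) with hs
  have hs0 : 0 ≤ s := div_nonneg (by linarith) hp1.le
  have hw : ainfCharD 1 (fun x => |x 0| ^ (δ - 1)) ≤ ENNReal.ofReal (4 * N) :=
    hNδ4 ▸ ainfCharD_abs_rpow_neg_le hδ hδ1
  have hσ : ainfCharD 1 (fun x => |x 0| ^ s) ≤ ENNReal.ofReal 8 := by
    refine (ainfCharD_abs_rpow_le hs0).trans (ENNReal.ofReal_le_ofReal ?_)
    have h1 : s ≤ 1 := by rw [hs, div_le_one hp1]; linarith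
    have h2 := Real.rpow_le_rpow_of_exponent_le (by norm_num : (1:ℝ) ≤ 2) h1
    rw [Real.rpow_one] at h2
    linarith
  have hap := apCharD_left_singular_le (p := p) (by linarith) hδ hδ1
  have hX := le_pNormD_one (p := p) (δ := δ) (b := 2 ^ (-(N:ℤ))) (M := (√N / 2) ^ p)
    (F := sqFnD 1 (fun y => dyadicStep (fun n => (-1:ℝ) ^ n) (y 0)))
    (w := fun x => |x 0| ^ (δ - 1)) hp0 hδ (by positivity) (by positivity) (by
      intro x hx
      have h1 := le_sqFnD_alternating hx
      have h2 : 0 ≤ √N / 2 := by positivity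
      rw [abs_of_nonneg (h2.trans h1), abs_of_pos hx.1]
      exact mul_le_mul_of_nonneg_right (Real.rpow_le_rpow h2 h1 hp0.le)
        (Real.rpow_nonneg hx.1.le _))
  have hf := pNormD_one_le (p := p) (δ := δ) (b := 1) (M := 1)
    (F := fun y => dyadicStep (fun n => (-1:ℝ) ^ n) (y 0) / |y 0| ^ s)
    (w := fun x => |x 0| ^ s) hp0 hδ zero_le_one zero_le_one
    (fun x hx => by simp [dyadicStep_of_notMem _ _ hx]) (by
      intro x hx
      have hpos := Real.rpow_pos_of_pos hx.1 s
      simp only [abs_of_pos hx.1]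
      rw [dyadicStep, indicator_of_mem hx, abs_div, abs_zpow, abs_neg, abs_one, one_zpow,
        abs_of_pos hpos, one_div, ← Real.rpow_neg hx.1.le, ← Real.rpow_mul hx.1.le,
        ← Real.rpow_add hx.1, one_mul]
      apply le_of_eq
      congr 1
      rw [hs]
      field_simp
      ring)
  have h := HC.real_bound hp0 hC hφmono hψmono (by linarith) (by linarith) (by positivity)
    (by positivity) (by linarith) hw hσ hap _ hX hf
  have hNp : 0 < (N:ℝ) ^ (1 / p) := Real.rpow_pos_of_pos hN0 _
  have hb : ((2:ℝ) ^ (-(N:ℤ))) ^ δ = 1 / 2 := by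
    rw [← Real.rpow_intCast, ← Real.rpow_mul (by norm_num)]
    have : ((-(N:ℤ) : ℤ) : ℝ) * δ = -1 := by rw [hδdef]; push_cast; field_simp
    rw [this, Real.rpow_neg_one, one_div]
  have hhalf : (1 / 2 : ℝ) ≤ (1 / 2) ^ (1 / p) := by
    have h1 : 1 / p ≤ 1 := by rw [div_le_one hp0]; linarith
    have := Real.rpow_le_rpow_of_exponent_ge (by norm_num : (0:ℝ) < 1 / 2) (by norm_num) h1
    rwa [Real.rpow_one] at this
  rw [hb, Real.one_rpow, hNδ, hNδ4, one_mul, div_eq_mul_one_div (1 / 2 : ℝ) δ, hNδ,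
    Real.mul_rpow (by positivity) (by positivity), ← Real.rpow_mul (by positivity),
    mul_one_div_cancel hp0.ne', Real.rpow_one,
    Real.mul_rpow (by positivity) (by positivity), ← mul_assoc,
    mul_le_mul_iff_left₀ hNp] at h
  calc √N = 4 * (√N / 2 * (1 / 2)) := by ring
    _ ≤ 4 * (√N / 2 * (1 / 2) ^ (1 / p)) := by gcongr
    _ ≤ _ := by gcongr

end Sharpness

/-- Let `p ∈ (2,∞)` and let `φ, ψ : [1,∞) → [1,∞)` be increasing with
`φ(1) = ψ(1) = 1`, such that for every `d ≥ 1` and all weights `w, σ` on `ℝ^d` with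
`[σ]_{A_∞} < ∞` and `[w]_{A_∞} < ∞` one has
`‖S(·σ)‖_{L^p(σ)→L^p(w)} ≤ C(p,d) [w,σ]_{A_p}^{1/p} (φ([w]_{A_∞}) + ψ([σ]_{A_∞}))`.
Then there are absolute constants `A, B > 0` with `ψ(x) ≥ c_p x^{1/p}` for `x > A` and
`φ(x) ≥ c_p x^{1/2 - 1/p}` for `x > B`, where `c_p > 0` depends only on `p`. -/
theorem statement2 (p : ℝ) (hp : 2 < p)
    (φ ψ : ℝ → ℝ)
    (hφmono : MonotoneOn φ (Set.Ici 1)) (hψmono : MonotoneOn ψ (Set.Ici 1))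
    (hφ1 : φ 1 = 1) (hψ1 : ψ 1 = 1)
    (hφmaps : ∀ x : ℝ, 1 ≤ x → 1 ≤ φ x) (hψmaps : ∀ x : ℝ, 1 ≤ x → 1 ≤ ψ x)
    (H : ∀ d : ℕ, 0 < d → ∃ C : ℝ, 0 < C ∧
      ∀ w σ : (Fin d → ℝ) → ℝ, IsWeightD d w → IsWeightD d σ →
        ainfCharD d σ < ⊤ → ainfCharD d w < ⊤ →
        ∀ f : (Fin d → ℝ) → ℝ, Measurable f →
          pNormD d p (sqFnD d (fun y => f y * σ y)) w ≤
            ENNReal.ofReal C * (apCharD d p w σ) ^ (1/p) *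
              ENNReal.ofReal
                (φ ((ainfCharD d w).toReal) + ψ ((ainfCharD d σ).toReal)) *
              pNormD d p f σ) :
    (∃ A > (0:ℝ), ∃ c > (0:ℝ), ∀ x : ℝ, A < x → c * x ^ (1/p) ≤ ψ x) ∧
    (∃ B > (0:ℝ), ∃ c > (0:ℝ), ∀ x : ℝ, B < x → c * x ^ (1/2 - 1/p) ≤ φ x) := by
  obtain ⟨C, hC, HC⟩ := H 1 one_pos
  have hp0 : 0 < p := by linarith
  have hp1 : 0 < p - 1 := by linarith
  constructor
  · set D : ℝ := 32 * C * (φ (4 * 2 ^ (p - 1)) + 1) with hD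
    have hK : (1:ℝ) ≤ 4 * 2 ^ (p - 1) := by
      have := Real.one_le_rpow (by norm_num : (1:ℝ) ≤ 2) hp1.le
      linarith
    have hφK := hφmaps _ hK
    have hDpos : 0 < D := by positivity
    refine ⟨16, by norm_num, 1 / D, by positivity, fun x hx => ?_⟩
    have h := rpow_le_of_sqFnD_bound_singular hp0 hp1 hφmono hψmono hφmaps hψmaps hC.le HC hx.le
    have hψx := hψmaps x (by linarith)
    rw [one_div_mul_eq_div, div_le_iff₀ hDpos]
    calc x ^ (1 / p) ≤ 32 * C * (φ (4 * 2 ^ (p - 1)) + ψ x) := h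
      _ ≤ 32 * C * (φ (4 * 2 ^ (p - 1)) * ψ x + 1 * ψ x) := by
          rw [one_mul]
          gcongr
          exact le_mul_of_one_le_right (by linarith) hψx
      _ = ψ x * D := by rw [hD]; ring
  · have hψK := hψmaps 8 (by norm_num)
    set D : ℝ := 16 * C * (1 + ψ 8) with hD
    have hDpos : 0 < D := by positivity
    refine ⟨4, by norm_num, 1 / D, by positivity, fun x hx => ?_⟩
    have hx0 : 0 < x := by linarith
    have hφx := hφmaps x (by linarith)
    set N : ℕ := ⌊x / 4⌋₊ with hN
    have hN1 : 1 ≤ N := Nat.le_floor (by push_cast; linarith)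
    have hN1' : (1:ℝ) ≤ N := by exact_mod_cast hN1
    have hNle : 4 * (N:ℝ) ≤ x := by
      have := Nat.floor_le (by positivity : 0 ≤ x / 4)
      linarith
    have hxle : x ≤ 8 * N := by
      have := Nat.lt_floor_add_one (x / 4)
      linarith
    have h := sqrt_le_of_sqFnD_bound_alternating hp hφmono hψmono hφmaps hψmaps hC.le HC hN1
    have hφN : φ (4 * N) ≤ φ x :=
      hφmono (mem_Ici.mpr (by linarith)) (mem_Ici.mpr (by linarith)) hNle
    have hφN1 := hφmaps (4 * N) (by linarith)
    have hsq : x ^ (1 / 2 : ℝ) ≤ 4 * √N := by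
      rw [← Real.sqrt_eq_rpow]
      calc √x ≤ √(4 ^ 2 * N) := Real.sqrt_le_sqrt (by linarith)
        _ = 4 * √N := by rw [Real.sqrt_mul (by norm_num), Real.sqrt_sq (by norm_num)]
    rw [Real.rpow_sub hx0, one_div_mul_eq_div, div_le_iff₀ hDpos,
      div_le_iff₀ (Real.rpow_pos_of_pos hx0 _)]
    calc x ^ (1 / 2 : ℝ) ≤ 4 * √N := hsq
      _ ≤ 4 * (4 * (C * (4 * (N:ℝ)) ^ (1 / p) * (φ (4 * N) + ψ 8))) := by linarith
      _ ≤ 4 * (4 * (C * x ^ (1 / p) * (φ x + ψ 8 * φ x))) := by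
          have : ψ 8 ≤ ψ 8 * φ x := le_mul_of_one_le_right (by linarith) hφx
          gcongr
      _ = φ x * D * x ^ (1 / p) := by rw [hD]; ring

end
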